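/- Let (Ĝ, π) be a C₂-graded finite group and let (V, ρ, (B_w)) be an irreducible H-representation of (Ĝ, π) whose underlying ℂG-module (V, ρ) is simple. Then: (1) the family (−B_w) also makes (V, ρ) an H-representation; (2) the H-representations (V, ρ, (B_w)) and (V, ρ, (−B_w)) are not isomorphic; and (3) every family of forms (B̃_w) making (V, ρ) an H-representation yields an H-representation isomorphic to either (V, ρ, (B_w)) or (V, ρ, (−B_w)). -/

import Mathlib

open scoped ComplexConjugate

noncomputable section Defs

variable {Ghat : Type} [Group Ghat]

/-- Conjugate `g ∈ G = ker π` by an arbitrary element `w` of the graded group. -/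
def conjKer (π : Ghat →* ℤˣ) (w : Ghat) (g : π.ker) : π.ker :=
  ⟨w * (g : Ghat) * w⁻¹, by
    have hg : π (g : Ghat) = 1 := g.2
    simp [MonoidHom.mem_ker, map_mul, map_inv, hg]⟩

/-- The square `w²` of any element lies in `G = ker π`. -/
def sqKer (π : Ghat →* ℤˣ) (w : Ghat) : π.ker :=
  ⟨w * w, by simp [MonoidHom.mem_ker, map_mul, Int.units_mul_self]⟩

/-- For odd `w₁, w₂`, the element `w₂ w₁⁻¹` lies in `G = ker π`. -/
def ratioKer (π : Ghat →* ℤˣ) (w₂ w₁ : Ghat) (h₂ : π w₂ = -1) (h₁ : π w₁ = -1) : π.ker :=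
  ⟨w₂ * w₁⁻¹, by simp [MonoidHom.mem_ker, map_mul, map_inv, h₁, h₂]⟩

/-- A family of forms `B w` (for odd `w`) making the `G`-representation `ρ` into a
hermitian `K`-representation of the `C₂`-graded group `(Ghat, π)` with respect to the
ring involution `ι` of `K`:  each `B w` is `ι`-sesquilinear, nondegenerate, `w`-invariant,
`w`-hermitian, and the various forms are compatible. -/
structure IsHermRep (K : Type) [Field K] (ι : K →+* K) (π : Ghat →* ℤˣ)
    {V : Type} [AddCommGroup V] [Module K V]
    (ρ : Representation K π.ker V) (B : Ghat → V → V → K) : Prop where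
  add_left : ∀ w, π w = -1 → ∀ u u' v : V, B w (u + u') v = B w u v + B w u' v
  smul_left : ∀ w, π w = -1 → ∀ (a : K) (u v : V), B w (a • u) v = ι a * B w u v
  add_right : ∀ w, π w = -1 → ∀ u v v' : V, B w u (v + v') = B w u v + B w u v'
  smul_right : ∀ w, π w = -1 → ∀ (a : K) (u v : V), B w u (a • v) = a * B w u v
  nondeg_left : ∀ w, π w = -1 → ∀ u : V, (∀ v, B w u v = 0) → u = 0
  nondeg_right : ∀ w, π w = -1 → ∀ v : V, (∀ u, B w u v = 0) → v = 0
  invariant : ∀ w, π w = -1 → ∀ (g : π.ker) (u v : V),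
      B w (ρ g u) (ρ (conjKer π w g) v) = B w u v
  hermitian : ∀ w, π w = -1 → ∀ u v : V, B w u (ρ (sqKer π w) v) = ι (B w v u)
  compat : ∀ w₁ w₂ (h₁ : π w₁ = -1) (h₂ : π w₂ = -1) (u v : V),
      B w₁ u v = B w₂ u (ρ (ratioKer π w₂ w₁ h₂ h₁) v)

/-- The right orthogonal complement of `W` with respect to the form `B w`. -/
def perp {K : Type} [Field K] {V : Type} [AddCommGroup V] [Module K V]
    (B : Ghat → V → V → K) (W : Submodule K V) (w : Ghat) : Set V :=
  {v : V | ∀ u ∈ W, B w u v = 0}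

/-- `W` is a subrepresentation: a `G`-invariant subspace on which every restricted
form is nondegenerate. -/
def IsSubrep (K : Type) [Field K] (π : Ghat →* ℤˣ)
    {V : Type} [AddCommGroup V] [Module K V]
    (ρ : Representation K π.ker V) (B : Ghat → V → V → K) (W : Submodule K V) : Prop :=
  (∀ (g : π.ker), ∀ v ∈ W, ρ g v ∈ W) ∧
  ∀ w, π w = -1 →
    (∀ u ∈ W, (∀ v ∈ W, B w u v = 0) → u = 0) ∧
    (∀ v ∈ W, (∀ u ∈ W, B w u v = 0) → v = 0)

/-- The hermitian representation `(V, B)` is irreducible. -/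
def IsIrredRep (K : Type) [Field K] (π : Ghat →* ℤˣ)
    {V : Type} [AddCommGroup V] [Module K V]
    (ρ : Representation K π.ker V) (B : Ghat → V → V → K) : Prop :=
  (∃ v : V, v ≠ 0) ∧ ∀ W : Submodule K V, IsSubrep K π ρ B W → W = ⊥ ∨ W = ⊤

/-- `W` is an irreducible subrepresentation. -/
def IsIrredSubrep (K : Type) [Field K] (π : Ghat →* ℤˣ)
    {V : Type} [AddCommGroup V] [Module K V]
    (ρ : Representation K π.ker V) (B : Ghat → V → V → K) (W : Submodule K V) : Prop :=
  IsSubrep K π ρ B W ∧ W ≠ ⊥ ∧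
    ∀ U : Submodule K V, U ≤ W → IsSubrep K π ρ B U → U = ⊥ ∨ U = W

/-- `W` is a `G`-invariant subspace that is simple as a `KG`-module. -/
def IsSimpleGSub (K : Type) [Field K] (π : Ghat →* ℤˣ)
    {V : Type} [AddCommGroup V] [Module K V]
    (ρ : Representation K π.ker V) (W : Submodule K V) : Prop :=
  (∀ (g : π.ker), ∀ v ∈ W, ρ g v ∈ W) ∧ W ≠ ⊥ ∧
    ∀ U : Submodule K V, U ≤ W → (∀ (g : π.ker), ∀ v ∈ U, ρ g v ∈ U) → U = ⊥ ∨ U = W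

/-- The group of automorphisms of a hermitian representation: the `G`-equivariant linear
automorphisms preserving every form `B w`. -/
def AutRep (K : Type) [Field K] (π : Ghat →* ℤˣ)
    {V : Type} [AddCommGroup V] [Module K V]
    (ρ : Representation K π.ker V) (B : Ghat → V → V → K) : Subgroup (V ≃ₗ[K] V) where
  carrier := {f | (∀ (g : π.ker) (v : V), f (ρ g v) = ρ g (f v)) ∧
      ∀ w, π w = -1 → ∀ u v : V, B w (f u) (f v) = B w u v}
  one_mem' := ⟨fun _ _ => rfl, fun _ _ _ _ => rfl⟩
  mul_mem' := by
    rintro f g ⟨hf1, hf2⟩ ⟨hg1, hg2⟩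
    refine ⟨fun a v => ?_, fun w hw u v => ?_⟩
    · show f (g (ρ a v)) = ρ a (f (g v))
      rw [hg1, hf1]
    · show B w (f (g u)) (f (g v)) = B w u v
      rw [hf2 w hw, hg2 w hw]
  inv_mem' := by
    rintro f ⟨hf1, hf2⟩
    refine ⟨fun g v => ?_, fun w hw u v => ?_⟩
    · apply f.injective
      show f (f.symm (ρ g v)) = f (ρ g (f.symm v))
      rw [f.apply_symm_apply, hf1, f.apply_symm_apply]
    · show B w (f.symm u) (f.symm v) = B w u v
      conv_rhs => rw [← f.apply_symm_apply u, ← f.apply_symm_apply v]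
      exact (hf2 w hw _ _).symm

/-- Linear (`L`-) representations: the hermitian theory over `ℂ` with the trivial involution. -/
abbrev IsLRep (π : Ghat →* ℤˣ) {V : Type} [AddCommGroup V] [Module ℂ V]
    (ρ : Representation ℂ π.ker V) (B : Ghat → V → V → ℂ) : Prop :=
  IsHermRep ℂ (RingHom.id ℂ) π ρ B

/-- Hermitian (`H`-) representations: the hermitian theory over `ℂ` with complex conjugation. -/
abbrev IsHRep (π : Ghat →* ℤˣ) {V : Type} [AddCommGroup V] [Module ℂ V]
    (ρ : Representation ℂ π.ker V) (B : Ghat → V → V → ℂ) : Prop :=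
  IsHermRep ℂ (starRingEnd ℂ) π ρ B

/-- An antilinear (`A`-) representation of the `C₂`-graded group `(Ghat, π)`: an action of the
whole group `Ghat` by additive automorphisms in which even elements act `ℂ`-linearly and odd
elements act conjugate-linearly. -/
structure IsARep (π : Ghat →* ℤˣ) {V : Type} [AddCommGroup V] [Module ℂ V]
    (a : Ghat → V → V) : Prop where
  map_add : ∀ (z : Ghat) (u v : V), a z (u + v) = a z u + a z v
  map_smul_even : ∀ z, π z = 1 → ∀ (c : ℂ) (v : V), a z (c • v) = c • a z v
  map_smul_odd : ∀ z, π z = -1 → ∀ (c : ℂ) (v : V), a z (c • v) = (starRingEnd ℂ c) • a z v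
  map_one : ∀ v : V, a 1 v = v
  map_mul : ∀ (z₁ z₂ : Ghat) (v : V), a (z₁ * z₂) v = a z₁ (a z₂ v)

/-- The componentwise action of `G` on the direct sum `V^{⊕n}`. -/
def piRep (π : Ghat →* ℤˣ) {V : Type} [AddCommGroup V] [Module ℂ V]
    (ρ : Representation ℂ π.ker V) (n : ℕ) : Representation ℂ π.ker (Fin n → V) where
  toFun g := LinearMap.pi fun i => (ρ g) ∘ₗ LinearMap.proj i
  map_one' := by
    ext v i
    simp
  map_mul' g h := by
    ext v i
    simp

/-- The orthogonal sum of the forms `B w` on the direct sum `V^{⊕n}`. -/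
def sumForm {V : Type} [AddCommGroup V] [Module ℂ V]
    (B : Ghat → V → V → ℂ) (n : ℕ) : Ghat → (Fin n → V) → (Fin n → V) → ℂ :=
  fun w u v => ∑ i, B w (u i) (v i)

/-- The bilinear forms `B_w(u,v) = ⟨u, w⁻¹·v⟩ + ⟨v, w·u⟩` associated with an invariant inner
product on an `A`-representation. -/
def assocForm {V : Type} [AddCommGroup V] [Module ℂ V]
    (a : Ghat → V → V) (h : V → V → ℂ) : Ghat → V → V → ℂ :=
  fun w u v => h u (a w⁻¹ v) + h v (a w u)

end Defs

/-- A `G`-invariant subspace of a simple `KG`-module with a nonzero vector is everything. -/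
theorem IsSimpleGSub.eq_top_of_mem {Ghat : Type} [Group Ghat] {K : Type} [Field K]
    {π : Ghat →* ℤˣ} {V : Type} [AddCommGroup V] [Module K V] {ρ : Representation K π.ker V}
    (hsimple : IsSimpleGSub K π ρ ⊤) {W : Submodule K V}
    (hW : ∀ (g : π.ker), ∀ v ∈ W, ρ g v ∈ W) {v : V} (hv : v ∈ W) (hv0 : v ≠ 0) : W = ⊤ := by
  refine (hsimple.2.2 W le_top hW).resolve_left fun h => hv0 ?_
  rwa [h, Submodule.mem_bot] at hv

theorem IsSimpleGSub.nontrivial {Ghat : Type} [Group Ghat] {K : Type} [Field K]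
    {π : Ghat →* ℤˣ} {V : Type} [AddCommGroup V] [Module K V] {ρ : Representation K π.ker V}
    (hsimple : IsSimpleGSub K π ρ ⊤) : Nontrivial V :=
  (Submodule.nontrivial_iff K).1 ⟨⊤, ⊥, hsimple.2.1⟩

/-- Schur's lemma: equivariant endomorphisms of a simple module are scalars. -/
theorem IsSimpleGSub.exists_eq_smul {Ghat : Type} [Group Ghat] {K : Type} [Field K]
    [IsAlgClosed K] {π : Ghat →* ℤˣ} {V : Type} [AddCommGroup V] [Module K V]
    [FiniteDimensional K V] {ρ : Representation K π.ker V} (hsimple : IsSimpleGSub K π ρ ⊤)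
    (f : V →ₗ[K] V) (hf : ∀ (g : π.ker) (v : V), f (ρ g v) = ρ g (f v)) :
    ∃ c : K, ∀ v, f v = c • v := by
  have := hsimple.nontrivial
  obtain ⟨c, hc⟩ := Module.End.exists_eigenvalue f
  obtain ⟨v, hv⟩ := hc.exists_hasEigenvector
  have htop : Module.End.eigenspace f c = ⊤ := by
    refine hsimple.eq_top_of_mem (fun g x hx => ?_) hv.1 hv.2
    rw [Module.End.mem_eigenspace_iff] at hx ⊢
    rw [hf, hx, map_smul]
  refine ⟨c, fun x => Module.End.mem_eigenspace_iff.1 ?_⟩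
  rw [htop]
  trivial

/-- `w`-invariance with the translation moved to the right argument alone. -/
theorem IsHermRep.apply_rho {Ghat : Type} [Group Ghat] {K : Type} [Field K] {ι : K →+* K}
    {π : Ghat →* ℤˣ} {V : Type} [AddCommGroup V] [Module K V] {ρ : Representation K π.ker V}
    {B : Ghat → V → V → K} (hB : IsHermRep K ι π ρ B) {w : Ghat} (hw : π w = -1)
    (g : π.ker) (u v : V) :
    B w u (ρ g v) = B w (ρ (conjKer π w⁻¹ g)⁻¹ u) v := by
  have h := hB.invariant w hw (conjKer π w⁻¹ g) (ρ (conjKer π w⁻¹ g)⁻¹ u) v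
  rw [Representation.self_inv_apply] at h
  rw [← h]
  congr 3
  ext
  simp [conjKer, mul_assoc]

/-- The right-hand argument of a form, tested against a basis. -/
noncomputable def IsHermRep.testMap {Ghat : Type} [Group Ghat] {K : Type} [Field K] {ι : K →+* K}
    {π : Ghat →* ℤˣ} {V : Type} [AddCommGroup V] [Module K V] {ρ : Representation K π.ker V}
    {B : Ghat → V → V → K} (hB : IsHermRep K ι π ρ B) {w : Ghat} (hw : π w = -1)
    {n : Type} (b : Module.Basis n K V) : V →ₗ[K] (n → K) where
  toFun v i := B w (b i) v
  map_add' v v' := funext fun i => hB.add_right w hw (b i) v v'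
  map_smul' a v := funext fun i => hB.smul_right w hw a (b i) v

/-- Sesquilinear forms in the left argument that are proportional on a basis are proportional. -/
theorem IsHermRep.eq_mul_of_basis {Ghat : Type} [Group Ghat] {K : Type} [Field K] {ι : K →+* K}
    {π : Ghat →* ℤˣ} {V : Type} [AddCommGroup V] [Module K V] {ρ : Representation K π.ker V}
    {B Bt : Ghat → V → V → K} (hB : IsHermRep K ι π ρ B) (hBt : IsHermRep K ι π ρ Bt)
    {w : Ghat} (hw : π w = -1) {n : Type} (b : Module.Basis n K V) {c : K} {v : V}
    (h : ∀ i, Bt w (b i) v = c * B w (b i) v) (u : V) : Bt w u v = c * B w u v := by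
  induction b.mem_span u using Submodule.span_induction with
  | zero =>
    have h₁ := hB.smul_left w hw 0 0 v
    have h₂ := hBt.smul_left w hw 0 0 v
    simp_all
  | mem x hx =>
    obtain ⟨i, rfl⟩ := hx
    exact h i
  | add x y _ _ hx hy => rw [hB.add_left w hw, hBt.add_left w hw, hx, hy, mul_add]
  | smul a x _ hx => rw [hB.smul_left w hw, hBt.smul_left w hw, hx, mul_left_comm]

/-- Two hermitian structures on a simple module are proportional. -/
theorem IsHermRep.exists_eq_mul {Ghat : Type} [Group Ghat] {K : Type} [Field K]
    [IsAlgClosed K] {ι : K →+* K} {π : Ghat →* ℤˣ} {V : Type} [AddCommGroup V] [Module K V]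
    [FiniteDimensional K V] {ρ : Representation K π.ker V} {B Bt : Ghat → V → V → K}
    (hB : IsHermRep K ι π ρ B) (hBt : IsHermRep K ι π ρ Bt) (hsimple : IsSimpleGSub K π ρ ⊤)
    {w : Ghat} (hw : π w = -1) :
    ∃ c : K, ∀ w', π w' = -1 → ∀ u v, Bt w' u v = c * B w' u v := by
  have := hsimple.nontrivial
  let b := Module.finBasis K V
  have hinj : Function.Injective (hB.testMap hw b) := by
    rw [injective_iff_map_eq_zero]
    intro v hv
    refine hB.nondeg_right w hw v fun u => ?_
    simpa using hB.eq_mul_of_basis hB hw b (c := 0) (v := v)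
      (fun i => by simpa [IsHermRep.testMap] using congrFun hv i) u
  let e := LinearEquiv.ofInjectiveOfFinrankEq (hB.testMap hw b) hinj (by simp)
  obtain ⟨c, hc⟩ := Module.End.exists_eigenvalue
    (e.symm.toLinearMap ∘ₗ hBt.testMap hw b : Module.End K V)
  obtain ⟨v, hv⟩ := hc.exists_hasEigenvector
  have hev : hBt.testMap hw b v = c • hB.testMap hw b v := by
    have h : e.symm (hBt.testMap hw b v) = c • v := hv.apply_eq_smul
    rw [LinearEquiv.symm_apply_eq, map_smul] at h
    exact h
  let W : Submodule K V :=
    { carrier := {v | ∀ u, Bt w u v = c * B w u v}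
      add_mem' := fun {x y} hx hy u => by
        rw [hB.add_right w hw, hBt.add_right w hw, hx u, hy u, mul_add]
      zero_mem' := fun u => by
        have h₁ := hB.smul_right w hw 0 u 0
        have h₂ := hBt.smul_right w hw 0 u 0
        simp_all
      smul_mem' := fun a x hx u => by
        rw [hB.smul_right w hw, hBt.smul_right w hw, hx u, mul_left_comm] }
  have hW : W = ⊤ := by
    refine hsimple.eq_top_of_mem (fun g x hx u => ?_)
      (hB.eq_mul_of_basis hBt hw b (congrFun hev) : v ∈ W) hv.2
    rw [hB.apply_rho hw, hBt.apply_rho hw, hx]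
  have hall : ∀ u v, Bt w u v = c * B w u v := fun u v =>
    (hW ▸ Submodule.mem_top : v ∈ W) u
  refine ⟨c, fun w' hw' u v => ?_⟩
  rw [hB.compat w' w hw' hw, hBt.compat w' w hw' hw, hall]

theorem IsHermRep.exists_ne_zero {Ghat : Type} [Group Ghat] {K : Type} [Field K] {ι : K →+* K}
    {π : Ghat →* ℤˣ} {V : Type} [AddCommGroup V] [Module K V] [Nontrivial V]
    {ρ : Representation K π.ker V} {B : Ghat → V → V → K} (hB : IsHermRep K ι π ρ B)
    {w : Ghat} (hw : π w = -1) : ∃ u v, B w u v ≠ 0 := by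
  obtain ⟨u, hu⟩ := exists_ne (0 : V)
  by_contra! h
  exact hu (hB.nondeg_left w hw u (h u))

theorem IsHermRep.neg {Ghat : Type} [Group Ghat] {K : Type} [Field K] {ι : K →+* K}
    {π : Ghat →* ℤˣ} {V : Type} [AddCommGroup V] [Module K V] {ρ : Representation K π.ker V}
    {B : Ghat → V → V → K} (hB : IsHermRep K ι π ρ B) :
    IsHermRep K ι π ρ (fun w u v => -(B w u v)) where
  add_left w hw u u' v := by rw [hB.add_left w hw, neg_add]
  smul_left w hw a u v := by rw [hB.smul_left w hw, mul_neg]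
  add_right w hw u v v' := by rw [hB.add_right w hw, neg_add]
  smul_right w hw a u v := by rw [hB.smul_right w hw, mul_neg]
  nondeg_left w hw u h := hB.nondeg_left w hw u fun v => neg_eq_zero.1 (h v)
  nondeg_right w hw v h := hB.nondeg_right w hw v fun u => neg_eq_zero.1 (h u)
  invariant w hw g u v := by rw [hB.invariant w hw]
  hermitian w hw u v := by rw [hB.hermitian w hw, map_neg]
  compat w₁ w₂ h₁ h₂ u v := by rw [hB.compat w₁ w₂ h₁ h₂]

/-- A real scalar acts on an `H`-representation by rescaling its forms by the square. -/
theorem IsHermRep.real_smul_smul {Ghat : Type} [Group Ghat] {π : Ghat →* ℤˣ} {V : Type}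
    [AddCommGroup V] [Module ℂ V] {ρ : Representation ℂ π.ker V} {B : Ghat → V → V → ℂ}
    (hB : IsHRep π ρ B) {w : Ghat} (hw : π w = -1) (s : ℝ) (u v : V) :
    B w ((s : ℂ) • u) ((s : ℂ) • v) = ((s * s : ℝ) : ℂ) * B w u v := by
  rw [hB.smul_left w hw, hB.smul_right w hw, Complex.conj_ofReal, Complex.ofReal_mul, mul_assoc]

theorem smul_id_bijective_equivariant {G K V : Type} [Group G] [Field K] [AddCommGroup V]
    [Module K V] (ρ : Representation K G V) {s : K} (hs : s ≠ 0) :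
    Function.Bijective (s • LinearMap.id : V →ₗ[K] V) ∧
      ∀ g v, (s • LinearMap.id : V →ₗ[K] V) (ρ g v) = ρ g ((s • LinearMap.id : V →ₗ[K] V) v) :=
  ⟨(LinearEquiv.smulOfNeZero K V s hs).bijective, fun g v => by simp⟩

/-- For an irreducible `H`-representation with simple underlying `ℂG`-module: the negated family
of forms is again an `H`-representation, it is not isomorphic to the original one, and every
`H`-structure on the same `ℂG`-module is isomorphic to one of these two. -/
theorem irred_H_rep_type1_two_structures
    {Ghat : Type} [Group Ghat] [Finite Ghat] (π : Ghat →* ℤˣ)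
    (hπ : Function.Surjective π)
    {V : Type} [AddCommGroup V] [Module ℂ V] [FiniteDimensional ℂ V]
    (ρ : Representation ℂ π.ker V) (B : Ghat → V → V → ℂ)
    (hB : IsHRep π ρ B) (hirr : IsIrredRep ℂ π ρ B)
    (hsimple : IsSimpleGSub ℂ π ρ (⊤ : Submodule ℂ V)) :
    IsHRep π ρ (fun w u v => -(B w u v)) ∧
    (¬ ∃ f : V →ₗ[ℂ] V, Function.Bijective f ∧
        (∀ (g : π.ker) (v : V), f (ρ g v) = ρ g (f v)) ∧
        (∀ w, π w = -1 → ∀ u v : V, -(B w (f u) (f v)) = B w u v)) ∧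
    (∀ Bt : Ghat → V → V → ℂ, IsHRep π ρ Bt →
      (∃ f : V →ₗ[ℂ] V, Function.Bijective f ∧
          (∀ (g : π.ker) (v : V), f (ρ g v) = ρ g (f v)) ∧
          (∀ w, π w = -1 → ∀ u v : V, B w (f u) (f v) = Bt w u v)) ∨
      (∃ f : V →ₗ[ℂ] V, Function.Bijective f ∧
          (∀ (g : π.ker) (v : V), f (ρ g v) = ρ g (f v)) ∧
          (∀ w, π w = -1 → ∀ u v : V, -(B w (f u) (f v)) = Bt w u v))) := by
  have := hsimple.nontrivial
  obtain ⟨w, hw⟩ := hπ (-1)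
  obtain ⟨x, y, hxy⟩ := hB.exists_ne_zero hw
  refine ⟨hB.neg, ?_, fun Bt hBt => ?_⟩
  · rintro ⟨f, -, hf, hfB⟩
    obtain ⟨c, hc⟩ := hsimple.exists_eq_smul f hf
    have h := hfB w hw x y
    rw [hc, hc, hB.smul_left w hw, hB.smul_right w hw, ← mul_assoc,
      ← Complex.normSq_eq_conj_mul_self, ← neg_mul] at h
    have h' : -(Complex.normSq c) = (1 : ℝ) := by
      exact_mod_cast mul_right_cancel₀ hxy (h.trans (one_mul _).symm)
    linarith [Complex.normSq_nonneg c]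
  · obtain ⟨c, hc⟩ := hB.exists_eq_mul hBt hsimple hw
    have hc0 : c ≠ 0 := by
      rintro rfl
      obtain ⟨u, v, huv⟩ := hBt.exists_ne_zero hw
      exact huv (by rw [hc w hw, zero_mul])
    have hreal : conj c = c := by
      have h := hBt.hermitian w hw y x
      rw [hc w hw, hc w hw, hB.hermitian w hw, map_mul] at h
      exact (mul_right_cancel₀ ((map_ne_zero _).2 hxy) h).symm
    obtain ⟨r, rfl⟩ := Complex.conj_eq_iff_real.1 hreal
    have hr : r ≠ 0 := by exact_mod_cast hc0
    have hs : ((√|r| : ℝ) : ℂ) ≠ 0 := by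
      exact_mod_cast (Real.sqrt_pos.2 (abs_pos.2 hr)).ne'
    obtain ⟨hbij, heq⟩ := smul_id_bijective_equivariant ρ hs
    have hform (w' : Ghat) (hw' : π w' = -1) (u v : V) :
        B w' (((√|r| : ℝ) : ℂ) • u) (((√|r| : ℝ) : ℂ) • v) = (|r| : ℝ) * B w' u v := by
      rw [hB.real_smul_smul hw', Real.mul_self_sqrt (abs_nonneg r)]
    rcases le_total 0 r with hr0 | hr0
    · refine Or.inl ⟨_, hbij, heq, fun w' hw' u v => ?_⟩
      refine (hform w' hw' u v).trans ?_
      rw [abs_of_nonneg hr0, hc w' hw']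
    · refine Or.inr ⟨_, hbij, heq, fun w' hw' u v => ?_⟩
      refine (congrArg Neg.neg (hform w' hw' u v)).trans ?_
      rw [abs_of_nonpos hr0, hc w' hw', Complex.ofReal_neg, neg_mul, neg_neg]
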